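/- Suppose d ≥ 3 is odd. For a Schwartz–Bruhat function Φ₂ on ℚ_p³ set h(ξ) = ∫_{ℚ_p∖{0}} ∫_{ℚ_p} Φ₂(u, (ξ−u²)/t, t) |t|_p^{(d−5)/2} du dt (an integral converging for every ξ ≠ 0 and defining a locally integrable function on ℚ_p). Then: (i) for every Schwartz–Bruhat function Φ on ℚ_p^d there exists a Schwartz–Bruhat Φ₂ on ℚ_p³ such that ∫_{ℚ_p^d} g(q_d(x)) Φ(x) dx = ∫_{ℚ_p} g(ξ) h(ξ) dξ for every continuous compactly supported g : ℚ_p → ℂ; and (ii) conversely, for every Schwartz–Bruhat Φ₂ on ℚ_p³ there exists a Schwartz–Bruhat Φ on ℚ_p^d for which the same identity holds. -/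

import Mathlib

open MeasureTheory Filter

noncomputable section

/-- A Schwartz–Bruhat function: locally constant with compact support. -/
def IsSchwartzBruhat {X : Type*} [TopologicalSpace X] (f : X → ℂ) : Prop :=
  IsLocallyConstant f ∧ HasCompactSupport f

/-- Extension of a vector in `ℚ_p^d` by zeros, for convenient indexing. -/
def padP {p : ℕ} [Fact p.Prime] {d : ℕ} (x : Fin d → ℚ_[p]) (n : ℕ) : ℚ_[p] :=
  if h : n < d then x ⟨n, h⟩ else 0

/-- The split quadratic form `q_d` on `ℚ_p^d`:
`x₁x₂ + x₃x₄ + ⋯ + x_{d−1}x_d` for `d` even, and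
`x₁² + x₂x₃ + ⋯ + x_{d−1}x_d` for `d` odd. -/
def splitQP (p : ℕ) [Fact p.Prime] (d : ℕ) (x : Fin d → ℚ_[p]) : ℚ_[p] :=
  if Even d then ∑ i ∈ Finset.range (d / 2), padP x (2 * i) * padP x (2 * i + 1)
  else padP x 0 ^ 2 + ∑ i ∈ Finset.range (d / 2), padP x (2 * i + 1) * padP x (2 * i + 2)

/-- The twisted pushforward
`h(ξ) = ∫_{ℚ_p∖{0}} ∫_{ℚ_p} Φ₂(u, (ξ−u²)/t, t) |t|_p^{(d−5)/2} du dt`. -/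
def hThreeP (p : ℕ) [Fact p.Prime] [MeasurableSpace ℚ_[p]] (μ : Measure ℚ_[p]) (d : ℕ)
    (Φ₂ : ℚ_[p] × ℚ_[p] × ℚ_[p] → ℂ) (ξ : ℚ_[p]) : ℂ :=
  ∫ t in ({0}ᶜ : Set ℚ_[p]),
    (∫ u : ℚ_[p], Φ₂ (u, (ξ - u ^ 2) / t, t) * ((‖t‖ ^ (((d : ℝ) - 5) / 2) : ℝ) : ℂ) ∂μ) ∂μ

section scaling
open scoped Pointwise ENNReal NNReal
variable {p : ℕ} [hp : Fact p.Prime] [MeasurableSpace ℚ_[p]] [BorelSpace ℚ_[p]]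
    (μ : Measure ℚ_[p]) [μ.IsAddHaarMeasure]

lemma haar_ball_p : (p : ℝ≥0∞) * μ (Metric.closedBall 0 ((p:ℝ)⁻¹)) = μ (Metric.closedBall 0 1) := by
  have hcov : Metric.closedBall (0:ℚ_[p]) 1 =
      ⋃ i ∈ Finset.range p, Metric.closedBall (i:ℚ_[p]) ((p:ℝ)⁻¹) := by
    ext x
    simp only [Metric.mem_closedBall, dist_zero_right, Set.mem_iUnion, Finset.mem_range, exists_prop]
    constructor
    · intro hx
      obtain ⟨X, hX⟩ : ∃ X : ℤ_[p], (X:ℚ_[p]) = x := ⟨⟨x,hx⟩, rfl⟩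
      obtain ⟨n, hn, hx'⟩ := PadicInt.exists_mem_range X
      refine ⟨n, hn, ?_⟩
      rw [PadicInt.maximalIdeal_eq_span_p, ← pow_one (p : ℤ_[p]), ← PadicInt.norm_le_pow_iff_mem_span_pow] at hx'
      rw [dist_eq_norm]
      rw [PadicInt.norm_def] at hx'
      have h2 : ((X - (n:ℤ_[p]) : ℤ_[p]) : ℚ_[p]) = x - n := by
        rw [PadicInt.coe_sub, PadicInt.coe_natCast, hX]
      rw [h2] at hx'
      simpa only [Nat.cast_one, zpow_neg, zpow_one] using hx'
    · rintro ⟨i, hi, h⟩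
      have h1 : ‖x - i‖ ≤ 1 := by
        rw [← dist_eq_norm]; refine h.trans ?_
        exact inv_le_one_of_one_le₀ (by exact_mod_cast hp.out.one_lt.le)
      have h2 : ‖(i:ℚ_[p])‖ ≤ 1 := by simpa using Padic.norm_int_le_one (p := p) (i:ℤ)
      calc ‖x‖ = ‖(x - i) + i‖ := by simp
        _ ≤ max _ _ := Padic.nonarchimedean _ _
        _ ≤ 1 := max_le h1 h2
  rw [hcov, measure_biUnion_finset]
  · have : ∀ i : ℕ, μ (Metric.closedBall (i:ℚ_[p]) ((p:ℝ)⁻¹)) = μ (Metric.closedBall 0 ((p:ℝ)⁻¹)) := by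
      intro i
      rw [← measure_preimage_add μ (i:ℚ_[p]) (Metric.closedBall (i:ℚ_[p]) ((p:ℝ)⁻¹))]
      congr 1; ext x; simp [dist_eq_norm]
    simp [this]
  · intro i hi j hj hij
    rw [Function.onFun, Set.disjoint_left]
    intro x hx hx'
    simp only [Metric.mem_closedBall, dist_eq_norm] at hx hx'
    apply hij
    have h3 : ‖(((i:ℤ) - (j:ℤ) : ℤ) : ℚ_[p])‖ ≤ (p:ℝ) ^ (-(1:ℕ):ℤ) := by
      have : (((i:ℤ) - (j:ℤ) : ℤ) : ℚ_[p]) = (x - j) + -(x - i) := by push_cast; ring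
      rw [this]
      refine (Padic.nonarchimedean _ _).trans ?_
      rw [norm_neg]
      simpa using ⟨hx', hx⟩
    rw [Padic.norm_int_le_pow_iff_dvd] at h3
    simp only [Finset.coe_range, Set.mem_Iio] at hi hj
    have := Int.eq_zero_of_abs_lt_dvd (by simpa using h3) (m := p) (by rw [abs_lt]; constructor <;> omega)
    omega
  · intro i _; exact Metric.isClosed_closedBall.measurableSet

lemma haarChar_padic (c : ℚ_[p]ˣ) : distribHaarChar ℚ_[p] c = ‖(c:ℚ_[p])‖₊ := by
  have hpne : (p:ℚ_[p]) ≠ 0 := by exact_mod_cast hp.out.ne_zero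
  have hp0 : (p:ℝ) ≠ 0 := by exact_mod_cast hp.out.ne_zero
  let P : ℚ_[p]ˣ := Units.mk0 (p:ℚ_[p]) hpne
  have hsm : ∀ (c : ℚ_[p]ˣ), c • Metric.closedBall (0:ℚ_[p]) 1 = Metric.closedBall (0:ℚ_[p]) ‖(c:ℚ_[p])‖ := by
    intro c
    rw [Units.smul_def, smul_closedBall' c.ne_zero]; simp
  have h0 : Measure.addHaar (Metric.closedBall (0:ℚ_[p]) 1) ≠ 0 := (Metric.measure_closedBall_pos _ _ one_pos).ne'
  have h1 : Measure.addHaar (Metric.closedBall (0:ℚ_[p]) 1) ≠ ∞ := measure_closedBall_lt_top.ne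
  have hP : distribHaarChar ℚ_[p] P = ‖(p:ℚ_[p])‖₊ := by
    apply distribHaarChar_eq_of_measure_smul_eq_mul h0 h1
    rw [hsm, ← haar_ball_p, ← mul_assoc]
    have : ‖(P:ℚ_[p])‖ = (p:ℝ)⁻¹ := by simp [P]
    rw [this]
    have : (‖(p:ℚ_[p])‖₊ : ℝ≥0∞) * p = 1 := by
      have : ‖(p:ℚ_[p])‖₊ = (p:ℝ≥0)⁻¹ := by ext; simp
      rw [this, ENNReal.coe_inv (by exact_mod_cast hp.out.ne_zero)]
      simp
      apply ENNReal.inv_mul_cancel <;> simp [hp.out.ne_zero]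
    rw [this, one_mul]
  have hc := Padic.norm_eq_zpow_neg_valuation (x := (c:ℚ_[p])) c.ne_zero
  set n := (c:ℚ_[p]).valuation
  have hcP : ‖(c:ℚ_[p])‖ = ‖((P ^ n : ℚ_[p]ˣ) : ℚ_[p])‖ := by
    rw [hc]; simp [P]
  have h2 : distribHaarChar ℚ_[p] c = distribHaarChar ℚ_[p] (P ^ n) := by
    apply ENNReal.coe_injective
    rw [distribHaarChar_eq_div h0 h1, distribHaarChar_eq_div h0 h1, hsm, hsm, hcP]
  rw [h2, map_zpow, hP]
  ext
  rw [coe_nnnorm, hcP]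
  simp [P]

lemma haar_map_mul (t : ℚ_[p]) (ht : t ≠ 0) (f : ℚ_[p] → ℝ≥0∞) (hf : Measurable f) :
    ∫⁻ x, f x ∂μ = ‖t‖ₑ * ∫⁻ x, f (t * x) ∂μ := by
  let e : ℚ_[p] ≃ᵐ ℚ_[p] := (Homeomorph.mulLeft₀ t ht).toMeasurableEquiv
  have key : μ = ‖t‖ₑ • Measure.map (fun x => t * x) μ := by
    ext s hs
    have := distribHaarChar_mul (μ := μ) (Units.mk0 t ht) ((fun x => t * x) ⁻¹' s)
    rw [haarChar_padic] at this
    rw [Measure.smul_apply, Measure.map_apply (by fun_prop) hs]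
    have h2 : (Units.mk0 t ht) • ((fun x => t * x) ⁻¹' s) = s := by
      ext x
      rw [Set.mem_smul_set]
      constructor
      · rintro ⟨y, hy, rfl⟩
        exact hy
      · intro hx
        exact ⟨t⁻¹ * x, by simpa [mul_inv_cancel_left₀ ht] using hx, by simp [Units.smul_def, mul_inv_cancel_left₀ ht]⟩
    rw [h2] at this
    rw [← this]; rfl
  conv_lhs => rw [key]
  rw [lintegral_smul_measure, lintegral_map hf (by fun_prop)]
  rfl

section sb
variable {E : Type*} [NormedAddCommGroup E]

/-- quantitative Schwartz-Bruhat -/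
def SBw (f : E → ℂ) (ε R : ℝ) : Prop :=
  (∀ x y, ‖x - y‖ ≤ ε → f x = f y) ∧ ∀ x, R < ‖x‖ → f x = 0

lemma sb_exists [ProperSpace E] {f : E → ℂ} (hf : IsSchwartzBruhat f) : ∃ ε > 0, ∃ R > 0, SBw f ε R := by
  obtain ⟨h1, h2⟩ := hf
  obtain ⟨δ, hδ, h⟩ := lebesgue_number_lemma_of_metric (s := tsupport f) (c := fun z : ℂ => f ⁻¹' {z}) h2
    (fun z => h1.isOpen_fiber z) (fun x _ => by simp)
  have key : ∀ x y, x ∈ tsupport f → ‖x - y‖ ≤ δ / 2 → f x = f y := by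
    intro x y hx hxy
    obtain ⟨i, hi⟩ := h x hx
    have a1 : f x = i := hi (Metric.mem_ball_self hδ)
    have a2 : f y = i := hi (by rw [Metric.mem_ball, dist_comm, dist_eq_norm]; linarith)
    rw [a1, a2]
  obtain ⟨R, hR, hR'⟩ := h2.isBounded.exists_pos_norm_le
  refine ⟨δ / 2, by positivity, R, hR, ?_, ?_⟩
  · intro x y hxy
    by_cases hx : x ∈ tsupport f
    · exact key x y hx hxy
    by_cases hy : y ∈ tsupport f
    · exact (key y x hy (by rwa [norm_sub_rev])).symm
    rw [image_eq_zero_of_notMem_tsupport hx, image_eq_zero_of_notMem_tsupport hy]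
  · intro x hx
    apply image_eq_zero_of_notMem_tsupport
    intro h; exact absurd (hR' x h) (by linarith)

lemma SBw.sb [ProperSpace E] {f : E → ℂ} {ε R : ℝ} (hε : 0 < ε) (h : SBw f ε R) : IsSchwartzBruhat f := by
  constructor
  · rw [IsLocallyConstant.iff_eventually_eq]
    intro x
    filter_upwards [Metric.closedBall_mem_nhds x hε] with y hy
    exact h.1 y x (by simpa [dist_eq_norm] using hy)
  · apply HasCompactSupport.of_support_subset_isCompact (isCompact_closedBall (0:E) R)
    intro x hx
    by_contra h'
    exact hx (h.2 x (by simpa using h'))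

lemma IsSchwartzBruhat.continuous {X : Type*} [TopologicalSpace X] {f : X → ℂ} (hf : IsSchwartzBruhat f) : Continuous f := hf.1.continuous

lemma IsSchwartzBruhat.bdd {X : Type*} [TopologicalSpace X] {f : X → ℂ} (hf : IsSchwartzBruhat f) :
    ∃ M > 0, ∀ x, ‖f x‖ ≤ M := by
  obtain ⟨M, hM⟩ := hf.2.exists_bound_of_continuous hf.continuous
  exact ⟨max M 1, by positivity, fun x => (hM x).trans (le_max_left _ _)⟩

lemma IsSchwartzBruhat.comp_homeo {X Y : Type*} [TopologicalSpace X] [TopologicalSpace Y] {f : X → ℂ} (hf : IsSchwartzBruhat f)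
    (e : Y ≃ₜ X) : IsSchwartzBruhat (fun y => f (e y)) :=
  ⟨hf.1.comp_continuous e.continuous, hf.2.comp_homeomorph e⟩

lemma IsSchwartzBruhat.const_mul {X : Type*} [TopologicalSpace X] {f : X → ℂ} (hf : IsSchwartzBruhat f) (c : ℂ) :
    IsSchwartzBruhat (fun y => c * f y) :=
  ⟨hf.1.comp (fun z => c * z), hf.2.mul_left⟩

lemma integrable_of_bdd [MeasurableSpace E] [BorelSpace E] [ProperSpace E] (ν : Measure E) [IsFiniteMeasureOnCompacts ν]
    {f : E → ℂ} (hm : Measurable f) (M R : ℝ) (hM : ∀ x, ‖f x‖ ≤ M) (hR : ∀ x, R < ‖x‖ → f x = 0) :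
    Integrable f ν := by
  have h : IntegrableOn f (Metric.closedBall 0 R) ν := by
    apply Measure.integrableOn_of_bounded (M := M)
    · exact measure_closedBall_lt_top.ne
    · exact hm.aestronglyMeasurable
    · exact Eventually.of_forall hM
  rw [integrableOn_iff_integrable_of_support_subset] at h
  · exact h
  · intro x hx
    by_contra h'
    exact hx (hR x (by simpa using h'))
end sb

section trans
open scoped ENNReal
variable {p : ℕ} [hp : Fact p.Prime] [MeasurableSpace ℚ_[p]] [BorelSpace ℚ_[p]]
    (μ : Measure ℚ_[p]) [μ.IsAddHaarMeasure]

/-- the change of variables -/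
def psiM (x : (ℚ_[p] × ℚ_[p]) × (ℚ_[p] × ℚ_[p])) : (ℚ_[p] × ℚ_[p]) × (ℚ_[p] × ℚ_[p]) :=
  ((x.1.1 - x.2.2 * x.2.1, x.1.2), (x.2.1, x.2.2 * x.1.2))

lemma measurable_psiM : Measurable (psiM (p := p)) := by
  unfold psiM; fun_prop

lemma lintegral_psi (F : (ℚ_[p] × ℚ_[p]) × (ℚ_[p] × ℚ_[p]) → ℝ≥0∞) (hF : Measurable F) :
    ∫⁻ x, F x ∂((μ.prod μ).prod (μ.prod μ)) = ∫⁻ x, ‖x.1.2‖ₑ * F (psiM x) ∂((μ.prod μ).prod (μ.prod μ)) := by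
  have perm : ∀ H : (ℚ_[p] × ℚ_[p]) × (ℚ_[p] × ℚ_[p]) → ℝ≥0∞, Measurable H →
      ∫⁻ x, H x ∂((μ.prod μ).prod (μ.prod μ)) = ∫⁻ C, ∫⁻ y, ∫⁻ z, ∫⁻ B, H ((B,C),(y,z)) ∂μ ∂μ ∂μ ∂μ := by
    intro H hH
    rw [lintegral_prod _ hH.aemeasurable, lintegral_prod_symm' _ (by fun_prop)]
    congr 1; ext C
    rw [lintegral_lintegral_swap (by fun_prop), lintegral_prod _ (by fun_prop)]
  rw [perm F hF, perm _ (by have := measurable_psiM (p := p); fun_prop)]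
  apply lintegral_congr_ae
  filter_upwards [compl_mem_ae_iff.2 (measure_singleton (μ := μ) 0)] with C hC
  congr 1; ext y
  rw [haar_map_mul μ C hC _ (by fun_prop), ← lintegral_const_mul _ (by fun_prop)]
  congr 1; ext w
  rw [lintegral_const_mul _ (by unfold psiM; fun_prop)]
  congr 1
  rw [← lintegral_sub_right_eq_self _ (w * y)]
  simp only [psiM, mul_comm]

lemma integral_psi (K : (ℚ_[p] × ℚ_[p]) × (ℚ_[p] × ℚ_[p]) → ℂ) (hK : Measurable K)
    (hi : Integrable K ((μ.prod μ).prod (μ.prod μ))) :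
    Integrable (fun x => (‖x.1.2‖ : ℂ) * K (psiM x)) ((μ.prod μ).prod (μ.prod μ)) ∧ 
    ∫ x, K x ∂((μ.prod μ).prod (μ.prod μ)) = ∫ x, (‖x.1.2‖ : ℂ) * K (psiM x) ∂((μ.prod μ).prod (μ.prod μ)) := by
  set ρ := (μ.prod μ).prod (μ.prod μ)
  have hm := measurable_psiM (p := p)
  have hd : Measurable (fun x : (ℚ_[p] × ℚ_[p]) × (ℚ_[p] × ℚ_[p]) => ‖x.1.2‖₊) := by fun_prop
  have key : ρ = Measure.map psiM (ρ.withDensity (fun x => (‖x.1.2‖₊ : ℝ≥0∞))) := by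
    ext s hs
    rw [Measure.map_apply hm hs, withDensity_apply _ (hm hs), ← lintegral_indicator_one hs, lintegral_psi μ _ (measurable_one.indicator hs),
      ← lintegral_indicator (hm hs)]
    refine lintegral_congr fun x => ?_
    by_cases h : psiM x ∈ s
    · have h' : x ∈ psiM ⁻¹' s := h
      simp [h, h', enorm]
    · have h' : x ∉ psiM ⁻¹' s := h
      simp [h, h']
  constructor
  · rw [key, integrable_map_measure hK.aestronglyMeasurable hm.aemeasurable, integrable_withDensity_iff_integrable_smul hd] at hi
    convert hi using 2
    rfl
  · conv_lhs => rw [key]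
    rw [integral_map hm.aemeasurable hK.aestronglyMeasurable, integral_withDensity_eq_integral_smul hd]
    rfl
end trans

section TTsec
set_option linter.unusedSectionVars false
open scoped ENNReal
variable {p : ℕ} [hp : Fact p.Prime] [MeasurableSpace ℚ_[p]] [BorelSpace ℚ_[p]]
    (μ : Measure ℚ_[p]) [μ.IsAddHaarMeasure]
variable {P : Type*} [NormedAddCommGroup P] [ProperSpace P]

/-- first integrand -/
def Tone (Φ : P × ((ℚ_[p] × ℚ_[p]) × (ℚ_[p] × ℚ_[p])) → ℂ) (x : P × (ℚ_[p] × ℚ_[p])) (v : ℚ_[p] × ℚ_[p]) : ℂ :=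
  if ‖v.2‖ ≤ 1 then Φ (x.1, ((x.2.1 - v.2 * v.1, x.2.2), (v.1, v.2 * x.2.2))) else 0

/-- second integrand -/
def Ttwo (k : ℕ) (Φ : P × ((ℚ_[p] × ℚ_[p]) × (ℚ_[p] × ℚ_[p])) → ℂ) (x : P × (ℚ_[p] × ℚ_[p])) (v : ℚ_[p] × ℚ_[p]) : ℂ :=
  if ‖v.2‖ < 1 then (‖v.2‖ : ℂ) ^ k * Φ (x.1, ((v.1, v.2 * x.2.2), (x.2.1 - v.2 * v.1, x.2.2))) else 0

/-- the fibre-integration operator -/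
def TT (k : ℕ) (Φ : P × ((ℚ_[p] × ℚ_[p]) × (ℚ_[p] × ℚ_[p])) → ℂ) (x : P × (ℚ_[p] × ℚ_[p])) : ℂ :=
  ∫ v, Tone Φ x v ∂(μ.prod μ) + ∫ v, Ttwo k Φ x v ∂(μ.prod μ)

lemma TT_SBw (k : ℕ) {Φ : P × ((ℚ_[p] × ℚ_[p]) × (ℚ_[p] × ℚ_[p])) → ℂ} {ε R : ℝ} (h : SBw Φ ε R) :
    SBw (TT μ k Φ) ε R := by
  constructor
  · intro x x' hx
    simp only [Prod.norm_def, Prod.fst_sub, Prod.snd_sub, sup_le_iff] at hx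
    obtain ⟨hxa, hxB, hxC⟩ := hx
    have h1 : Tone Φ x = Tone Φ x' := by
      ext v
      unfold Tone
      split_ifs with hv
      · apply h.1
        simp only [Prod.norm_def, Prod.fst_sub, Prod.snd_sub, sup_le_iff, sub_sub_sub_cancel_right, sub_self, norm_zero, ← mul_sub, norm_mul]
        refine ⟨hxa, ⟨hxB, hxC⟩, (norm_nonneg _).trans hxa, ?_⟩
        exact (mul_le_of_le_one_left (norm_nonneg _) hv).trans hxC
      · rfl
    have h2 : Ttwo k Φ x = Ttwo k Φ x' := by
      ext v
      unfold Ttwo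
      split_ifs with hv
      · congr 1
        apply h.1
        simp only [Prod.norm_def, Prod.fst_sub, Prod.snd_sub, sup_le_iff, sub_sub_sub_cancel_right, sub_self, norm_zero, ← mul_sub, norm_mul]
        refine ⟨hxa, ⟨(norm_nonneg _).trans hxa, ?_⟩, hxB, hxC⟩
        exact (mul_le_of_le_one_left (norm_nonneg _) hv.le).trans hxC
      · rfl
    unfold TT; rw [h1, h2]
  · intro x hx
    have key : ∀ B w y : ℚ_[p], ‖w‖ ≤ 1 → ‖B - w * y‖ ≤ R → ‖y‖ ≤ R → ‖B‖ ≤ R := by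
      intro B w y hw h1 h2
      calc ‖B‖ = ‖(B - w * y) + w * y‖ := by simp
        _ ≤ max _ _ := Padic.nonarchimedean _ _
        _ ≤ R := max_le h1 (by rw [norm_mul]; exact (mul_le_of_le_one_left (norm_nonneg _) hw).trans h2)
    have h1 : Tone Φ x = 0 := by
      ext v
      unfold Tone
      split_ifs with hv
      · apply h.2
        contrapose! hx
        simp only [Prod.norm_def, sup_le_iff] at hx ⊢
        exact ⟨hx.1, key _ _ _ hv hx.2.1.1 hx.2.2.1, hx.2.1.2⟩
      · rfl
    have h2 : Ttwo k Φ x = 0 := by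
      ext v
      unfold Ttwo
      split_ifs with hv
      · rw [h.2, mul_zero]; rfl
        contrapose! hx
        simp only [Prod.norm_def, sup_le_iff] at hx ⊢
        exact ⟨hx.1, key _ _ _ hv.le hx.2.2.1 hx.2.1.1, hx.2.2.2⟩
      · rfl
    unfold TT; rw [h1, h2]; simp

lemma Tone_integrable {Φ : P × ((ℚ_[p] × ℚ_[p]) × (ℚ_[p] × ℚ_[p])) → ℂ} (h : IsSchwartzBruhat Φ) (x) :
    Integrable (Tone Φ x) (μ.prod μ) := by
  obtain ⟨ε, hε, R, hR, hw⟩ := sb_exists h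
  obtain ⟨M, hM, hb⟩ := h.bdd
  have hc := h.continuous
  apply integrable_of_bdd _ (M := M) (R := max 1 R)
  · unfold Tone
    apply Measurable.ite _ _ measurable_const
    · exact measurableSet_le (by fun_prop) (by fun_prop)
    · apply Continuous.measurable; fun_prop
  · intro v; unfold Tone; split_ifs
    · exact hb _
    · simpa using hM.le
  · intro v hv
    unfold Tone
    split_ifs with h1
    · apply hw.2
      simp only [Prod.norm_def, lt_sup_iff, sup_lt_iff] at hv ⊢
      rcases hv with hv | hv
      · simp [hv.2]
      · linarith [hv.1]
    · rfl

lemma Ttwo_integrable (k : ℕ) {Φ : P × ((ℚ_[p] × ℚ_[p]) × (ℚ_[p] × ℚ_[p])) → ℂ} (h : IsSchwartzBruhat Φ) (x) :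
    Integrable (Ttwo k Φ x) (μ.prod μ) := by
  obtain ⟨ε, hε, R, hR, hw⟩ := sb_exists h
  obtain ⟨M, hM, hb⟩ := h.bdd
  have hc := h.continuous
  apply integrable_of_bdd _ (M := M) (R := max 1 R)
  · unfold Ttwo
    apply Measurable.ite _ _ measurable_const
    · exact measurableSet_lt (by fun_prop) (by fun_prop)
    · apply Continuous.measurable; fun_prop
  · intro v; unfold Ttwo; split_ifs with h1
    · rw [norm_mul, norm_pow]
      refine (mul_le_of_le_one_left (norm_nonneg _) ?_).trans (hb _)
      apply pow_le_one₀ (norm_nonneg _)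
      simpa using h1.le
    · simpa using hM.le
  · intro v hv
    unfold Ttwo
    split_ifs with h1
    · rw [hw.2, mul_zero]
      simp only [Prod.norm_def, lt_sup_iff, sup_lt_iff] at hv ⊢
      rcases hv with hv | hv
      · simp [hv.2]
      · linarith [hv.1]
    · rfl

lemma TT_sub (k : ℕ) {Φ Ψ : P × ((ℚ_[p] × ℚ_[p]) × (ℚ_[p] × ℚ_[p])) → ℂ} (h : IsSchwartzBruhat Φ)
    (h' : IsSchwartzBruhat Ψ) (x) : TT μ k (fun x => Φ x - Ψ x) x = TT μ k Φ x - TT μ k Ψ x := by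
  have h1 : Tone (fun x => Φ x - Ψ x) x = fun v => Tone Φ x v - Tone Ψ x v := by
    ext v; unfold Tone; split_ifs <;> simp
  have h2 : Ttwo k (fun x => Φ x - Ψ x) x = fun v => Ttwo k Φ x v - Ttwo k Ψ x v := by
    ext v; unfold Ttwo; split_ifs <;> simp [mul_sub]
  unfold TT
  rw [h1, h2, integral_sub (Tone_integrable μ h x) (Tone_integrable μ h' x),
    integral_sub (Ttwo_integrable μ k h x) (Ttwo_integrable μ k h' x)]
  ring

lemma TT_identity (k : ℕ) {Φ : P × ((ℚ_[p] × ℚ_[p]) × (ℚ_[p] × ℚ_[p])) → ℂ} (h : IsSchwartzBruhat Φ)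
    (a : P) (G : ℚ_[p] → ℂ) (hG : Continuous G) :
    ∫ x, G (x.1.1 * x.1.2 + x.2.1 * x.2.2) * (‖x.1.2‖ : ℂ) ^ k * Φ (a, x) ∂((μ.prod μ).prod (μ.prod μ)) =
    ∫ v, G (v.1 * v.2) * (‖v.2‖ : ℂ) ^ (k + 1) * TT μ k Φ (a, v) ∂(μ.prod μ) := by
  obtain ⟨ε, hε, R, hR, hw⟩ := sb_exists h
  have hc := h.continuous
  let K : (ℚ_[p] × ℚ_[p]) × (ℚ_[p] × ℚ_[p]) → ℂ := fun x => G (x.1.1 * x.1.2 + x.2.1 * x.2.2) * (‖x.1.2‖ : ℂ) ^ k * Φ (a, x)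
  have hKc : Continuous K := by fun_prop
  have hs : HasCompactSupport (fun x => Φ (a, x)) := by
    apply HasCompactSupport.of_support_subset_isCompact (isCompact_closedBall 0 R)
    intro x hx
    by_contra h'
    refine hx (hw.2 _ ?_)
    rw [Prod.norm_def]
    exact lt_of_lt_of_le (by simpa using h') (le_max_right _ _)
  have hKi : Integrable K ((μ.prod μ).prod (μ.prod μ)) := hKc.integrable_of_hasCompactSupport hs.mul_left
  let K1 : (ℚ_[p] × ℚ_[p]) × (ℚ_[p] × ℚ_[p]) → ℂ := fun x => if ‖x.2.2‖ ≤ ‖x.1.2‖ then K x else 0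
  let K2 : (ℚ_[p] × ℚ_[p]) × (ℚ_[p] × ℚ_[p]) → ℂ := fun x => if ‖x.2.2‖ < ‖x.1.2‖ then K x.swap else 0
  have m1 : MeasurableSet {x : (ℚ_[p] × ℚ_[p]) × (ℚ_[p] × ℚ_[p]) | ‖x.2.2‖ ≤ ‖x.1.2‖} :=
    measurableSet_le (by fun_prop) (by fun_prop)
  have m2 : MeasurableSet {x : (ℚ_[p] × ℚ_[p]) × (ℚ_[p] × ℚ_[p]) | ‖x.2.2‖ < ‖x.1.2‖} :=
    measurableSet_lt (by fun_prop) (by fun_prop)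
  have hK1m : Measurable K1 := Measurable.ite m1 hKc.measurable measurable_const
  have hK2m : Measurable K2 := Measurable.ite m2 (hKc.measurable.comp measurable_swap) measurable_const
  have hK1i : Integrable K1 ((μ.prod μ).prod (μ.prod μ)) := by
    refine (hKi.indicator m1).congr (Eventually.of_forall fun x => ?_)
    simp [K1, Set.indicator_apply]
  have hK2i : Integrable K2 ((μ.prod μ).prod (μ.prod μ)) := by
    refine (hKi.swap.indicator m2).congr (Eventually.of_forall fun x => ?_)
    simp [K2, Set.indicator_apply]
  have split : ∫ x, K x ∂((μ.prod μ).prod (μ.prod μ)) =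
      ∫ x, K1 x ∂((μ.prod μ).prod (μ.prod μ)) + ∫ x, K2 x ∂((μ.prod μ).prod (μ.prod μ)) := by
    rw [← integral_prod_swap K2]
    refine Eq.trans ?_ (integral_add hK1i hK2i.swap)
    congr 1; ext x
    simp only [K1, K2, Function.comp, Prod.snd_swap, Prod.fst_swap, Prod.swap_swap]
    rcases le_or_gt ‖x.2.2‖ ‖x.1.2‖ with h1 | h1
    · simp [h1, not_lt.2 h1]
    · simp [h1, not_le.2 h1]
  change ∫ x, K x ∂((μ.prod μ).prod (μ.prod μ)) = _
  obtain ⟨i1, e1⟩ := integral_psi μ K1 hK1m hK1i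
  obtain ⟨i2, e2⟩ := integral_psi μ K2 hK2m hK2i
  rw [split, e1, e2, integral_prod _ i1, integral_prod _ i2, ← integral_add i1.integral_prod_left i2.integral_prod_left]
  congr 1; ext ⟨B, C⟩
  rw [TT, mul_add, ← integral_const_mul, ← integral_const_mul]
  by_cases hC : C = 0
  · simp [hC]
  have hC' : 0 < ‖C‖ := norm_pos_iff.2 hC
  congr 2
  · ext ⟨y, w⟩
    simp only [K1, K, psiM, Tone, norm_mul, mul_le_iff_le_one_left hC']
    split_ifs with h1
    · rw [show (B - w * y) * C + y * (w * C) = B * C by ring]; ring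
    · simp
  · ext ⟨y, w⟩
    simp only [K2, K, psiM, Ttwo, norm_mul, mul_lt_iff_lt_one_left hC', Prod.swap]
    split_ifs with h1
    · rw [show y * (w * C) + (B - w * y) * C = B * C by ring]; push_cast; ring
    · simp
end TTsec

section Surj
set_option linter.unusedSectionVars false
variable {p : ℕ} [hp : Fact p.Prime] [MeasurableSpace ℚ_[p]] [BorelSpace ℚ_[p]]
    (μ : Measure ℚ_[p]) [μ.IsAddHaarMeasure]
variable {P : Type*} [NormedAddCommGroup P] [ProperSpace P]

lemma nn_add {x y : ℚ_[p]} {r : ℝ} (hx : ‖x‖ ≤ r) (hy : ‖y‖ ≤ r) : ‖x + y‖ ≤ r :=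
  (Padic.nonarchimedean _ _).trans (max_le hx hy)
lemma nn_sub {x y : ℚ_[p]} {r : ℝ} (hx : ‖x‖ ≤ r) (hy : ‖y‖ ≤ r) : ‖x - y‖ ≤ r := by
  rw [sub_eq_add_neg]; exact nn_add hx (by rwa [norm_neg])
lemma nn_of_sub {x y : ℚ_[p]} {r : ℝ} (hx : ‖x - y‖ ≤ r) (hy : ‖y‖ ≤ r) : ‖x‖ ≤ r := by
  rw [← sub_add_cancel x y]; exact nn_add hx hy
lemma nn_iff {x y : ℚ_[p]} {r : ℝ} (h : ‖x - y‖ ≤ r) : ‖x‖ ≤ r ↔ ‖y‖ ≤ r :=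
  ⟨fun hx => nn_of_sub (by rwa [norm_sub_rev]) hx, fun hy => nn_of_sub h hy⟩
lemma nn_max {x y : ℚ_[p]} {r : ℝ} (h : ‖x - y‖ ≤ r) : max ‖x‖ r = max ‖y‖ r := by
  apply le_antisymm
  · exact max_le (nn_of_sub (y := y) (h.trans (le_max_right _ _)) (le_max_left _ _)) (le_max_right _ _)
  · exact max_le (nn_of_sub (y := x) ((norm_sub_rev y x ▸ h).trans (le_max_right _ _)) (le_max_left _ _)) (le_max_right _ _)
lemma nn_mul {x y : ℚ_[p]} {r : ℝ} (hx : ‖x‖ ≤ 1) (hy : ‖y‖ ≤ r) : ‖x * y‖ ≤ r := by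
  rw [norm_mul]; exact (mul_le_of_le_one_left (norm_nonneg _) hx).trans hy

/-- the trial function -/
def Lam (m : ℝ → ℂ) (ε : ℝ) (Φ' : P × (ℚ_[p] × ℚ_[p]) → ℂ) (x : P × ((ℚ_[p] × ℚ_[p]) × (ℚ_[p] × ℚ_[p]))) : ℂ :=
  m (max ‖x.2.1.2‖ ε) * (if ‖x.2.2.1‖ ≤ ε ∧ ‖x.2.2.2‖ ≤ ε then Φ' (x.1, x.2.1) else 0)

lemma Lam_SBw (m : ℝ → ℂ) {ε R : ℝ} {Φ' : P × (ℚ_[p] × ℚ_[p]) → ℂ} (h : SBw Φ' ε R) :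
    SBw (Lam m ε Φ') ε (max R ε) := by
  constructor
  · intro x x' hx
    simp only [Prod.norm_def, Prod.fst_sub, Prod.snd_sub, sup_le_iff] at hx
    obtain ⟨hxa, ⟨hxB, hxC⟩, hxy, hxz⟩ := hx
    unfold Lam
    rw [nn_max hxC, h.1 (x.1, x.2.1) (x'.1, x'.2.1)]
    · simp only [nn_iff hxy, nn_iff hxz]
    · simp [Prod.norm_def, hxa, hxB, hxC]
  · intro x hx
    unfold Lam
    split_ifs with h1
    · rw [h.2, mul_zero]
      contrapose! hx
      simp only [Prod.norm_def, sup_le_iff] at hx ⊢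
      have i1 := le_max_left R ε
      have i2 := le_max_right R ε
      exact ⟨hx.1.trans i1, ⟨hx.2.1.trans i1, hx.2.2.trans i1⟩, h1.1.trans i2, h1.2.trans i2⟩
    · simp

/-- volume -/
def V1set (ε c : ℝ) : Set (ℚ_[p] × ℚ_[p]) := {v | ‖v.2‖ ≤ 1 ∧ ‖v.1‖ ≤ ε ∧ ‖v.2‖ * c ≤ ε}

lemma V1meas (ε c : ℝ) : MeasurableSet (V1set (p := p) ε c) := by
  have h1 : MeasurableSet {v : ℚ_[p] × ℚ_[p] | ‖v.2‖ ≤ 1} := measurableSet_le (by fun_prop) (by fun_prop)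
  have h2 : MeasurableSet {v : ℚ_[p] × ℚ_[p] | ‖v.1‖ ≤ ε} := measurableSet_le (by fun_prop) (by fun_prop)
  have h3 : MeasurableSet {v : ℚ_[p] × ℚ_[p] | ‖v.2‖ * c ≤ ε} := measurableSet_le (by fun_prop) (by fun_prop)
  exact h1.inter (h2.inter h3)

lemma V1pos (ε c : ℝ) (hε : 0 < ε) (hc : 0 < c) : 0 < (μ.prod μ).real (V1set (p := p) ε c) := by
  rw [measureReal_def]
  apply ENNReal.toReal_pos
  · apply ne_of_gt
    have : 0 < (μ.prod μ) (Metric.closedBall 0 (min (min 1 ε) (ε / c))) :=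
      Metric.measure_closedBall_pos _ _ (by positivity)
    refine this.trans_le (measure_mono ?_)
    intro v hv
    simp only [Metric.mem_closedBall, dist_zero_right, Prod.norm_def, sup_le_iff, le_inf_iff] at hv
    exact ⟨hv.1.1.2, hv.1.2.1, by rw [← le_div_iff₀ hc]; exact hv.2.2⟩
  · apply ne_of_lt
    refine (measure_mono (t := Metric.closedBall 0 (max 1 ε)) ?_).trans_lt measure_closedBall_lt_top
    intro v hv
    simp only [Metric.mem_closedBall, dist_zero_right, Prod.norm_def]
    exact max_le (hv.2.1.trans (le_max_right _ _)) (hv.1.trans (le_max_left _ _))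

lemma Tone_Lam (m : ℝ → ℂ) {ε R : ℝ} (hε : 0 < ε) {Φ' : P × (ℚ_[p] × ℚ_[p]) → ℂ} (h : SBw Φ' ε R) (x) :
    ∫ v, Tone (Lam m ε Φ') x v ∂(μ.prod μ) =
      ((μ.prod μ).real (V1set (p := p) ε (max ‖x.2.2‖ ε)) : ℂ) * (m (max ‖x.2.2‖ ε) * Φ' x) := by
  have : Tone (Lam m ε Φ') x = (V1set (p := p) ε (max ‖x.2.2‖ ε)).indicator (fun _ => m (max ‖x.2.2‖ ε) * Φ' x) := by
    ext v
    unfold Tone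
    split_ifs with h1
    · have e1 : ‖v.2 * x.2.2‖ ≤ ε ↔ ‖v.2‖ * max ‖x.2.2‖ ε ≤ ε := by
        rw [mul_max_of_nonneg _ _ (norm_nonneg _), norm_mul, max_le_iff]
        have := mul_le_of_le_one_left hε.le h1
        tauto
      by_cases h2 : v ∈ V1set (p := p) ε (max ‖x.2.2‖ ε)
      · rw [Set.indicator_of_mem h2]
        unfold Lam
        simp only
        rw [if_pos ⟨h2.2.1, e1.2 h2.2.2⟩, h.1 _ x]
        simp only [Prod.norm_def, Prod.fst_sub, Prod.snd_sub, sub_self, norm_zero, sup_le_iff, sub_sub_cancel_left, norm_neg]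
        exact ⟨hε.le, nn_mul h1 h2.2.1, hε.le⟩
      · rw [Set.indicator_of_notMem h2]
        unfold Lam
        simp only
        rw [if_neg, mul_zero]
        intro h3
        exact h2 ⟨h1, h3.1, e1.1 h3.2⟩
    · rw [Set.indicator_of_notMem]
      intro h2; exact h1 h2.1
  rw [this, integral_indicator (V1meas _ _), setIntegral_const]
  simp

lemma Ttwo_Lam_zero (k : ℕ) (m : ℝ → ℂ) {ε R : ℝ} (hε : 0 < ε) {Φ' : P × (ℚ_[p] × ℚ_[p]) → ℂ} (h : SBw Φ' ε R)
    (hs : ∀ a B C, ε < ‖B‖ → Φ' (a, (B, C)) = 0) (x) :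
    ∫ v, Ttwo k (Lam m ε Φ') x v ∂(μ.prod μ) =
      ((∫ v : ℚ_[p] × ℚ_[p], (if ‖v.2‖ < 1 ∧ ‖v.1‖ ≤ ε then ‖v.2‖ ^ k else 0 : ℝ) ∂(μ.prod μ) : ℝ) : ℂ) * (if max ‖x.2.2‖ ε = ε then m (max ‖x.2.2‖ ε) * Φ' x else 0) := by
  rw [← integral_complex_ofReal, ← integral_mul_const]
  congr 1; ext v
  obtain ⟨a, B, C⟩ := x
  obtain ⟨y, w⟩ := v
  simp only [Ttwo, Lam, sup_eq_right]
  by_cases hw : ‖w‖ < 1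
  swap
  · simp [hw]
  by_cases hC : ‖C‖ ≤ ε
  swap
  · simp [hC]
  have hwC : ‖w * C‖ ≤ ε := nn_mul hw.le hC
  by_cases hy : ‖y‖ ≤ ε
  swap
  · rw [hs _ _ _ (not_le.1 hy)]; simp [hy]
  have hwy : ‖w * y‖ ≤ ε := nn_mul hw.le hy
  have e1 : ‖B - w * y‖ ≤ ε ↔ ‖B‖ ≤ ε := nn_iff (by simpa using hwy)
  by_cases hB : ‖B‖ ≤ ε
  · simp only [hw, hC, hy, hB, e1, max_eq_right hwC, max_eq_right hC, and_self, if_true]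
    rw [h.1 (a, (y, w * C)) (a, (B, C))]
    · push_cast; ring
    · simp only [Prod.norm_def, Prod.fst_sub, Prod.snd_sub, sub_self, norm_zero, sup_le_iff]
      exact ⟨hε.le, nn_sub hy hB, nn_sub hwC hC⟩
  · rw [hs a B C (not_le.1 hB)]
    simp [e1, hB]

lemma Ttwo_Lam_supp (k N : ℕ) (m : ℝ → ℂ) {ε : ℝ} (hε : 0 < ε) {Φ' : P × (ℚ_[p] × ℚ_[p]) → ℂ}
    (hs : ∀ a B C, ε * p ^ (N + 1) < ‖B‖ → Φ' (a, (B, C)) = 0) (a : P) (B C : ℚ_[p]) (hB : ε * p ^ N < ‖B‖) :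
    ∫ v, Ttwo k (Lam m ε Φ') (a, (B, C)) v ∂(μ.prod μ) = 0 := by
  have hp1 : (1:ℝ) < p := by exact_mod_cast hp.out.one_lt
  have : Ttwo k (Lam m ε Φ') (a, (B, C)) = 0 := by
    ext ⟨y, w⟩
    simp only [Ttwo, Lam, Pi.zero_apply]
    by_cases hw : ‖w‖ < 1
    swap
    · simp [hw]
    by_cases hy : ε * p ^ (N + 1) < ‖y‖
    · simp [hs _ _ _ hy]
    rw [if_neg (c := ‖B - w * y‖ ≤ ε ∧ ‖C‖ ≤ ε)]
    · simp
    rintro ⟨h1, -⟩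
    have hw' : ‖w‖ ≤ (p:ℝ)⁻¹ := by
      have := (Padic.norm_le_pow_iff_norm_lt_pow_add_one w (-1)).2 (by simpa using hw)
      simpa using this
    have h2 : ‖w * y‖ ≤ ε * p ^ N := by
      rw [norm_mul]
      calc ‖w‖ * ‖y‖ ≤ (p:ℝ)⁻¹ * (ε * p ^ (N + 1)) := by
            apply mul_le_mul hw' (not_lt.1 hy) (norm_nonneg _) (by positivity)
        _ = ε * p ^ N := by rw [pow_succ]; field_simp
    have h3 : ε ≤ ε * p ^ N := le_mul_of_one_le_right hε.le (one_le_pow₀ hp1.le)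
    exact absurd (nn_of_sub (h1.trans h3) h2) (not_le.2 hB)
  rw [this]; simp

lemma TT_surj_aux (k : ℕ) {ε : ℝ} (hε : 0 < ε) (N : ℕ) : ∀ Φ' : P × (ℚ_[p] × ℚ_[p]) → ℂ, (∃ R, SBw Φ' ε R) →
    (∀ a B C, ε * p ^ N < ‖B‖ → Φ' (a, (B, C)) = 0) →
    ∃ Λ, (∃ R, SBw Λ ε R) ∧ ∀ x, TT μ k Λ x = Φ' x := by
  induction N with
  | zero =>
    rintro Φ' ⟨R, h⟩ hs
    set V2 : ℝ := ∫ v : ℚ_[p] × ℚ_[p], (if ‖v.2‖ < 1 ∧ ‖v.1‖ ≤ ε then ‖v.2‖ ^ k else 0 : ℝ) ∂(μ.prod μ) with hV2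
    have hV2' : 0 ≤ V2 := by
      apply integral_nonneg; intro v; dsimp only; split_ifs <;> positivity
    let m : ℝ → ℂ := fun c => ((((μ.prod μ).real (V1set (p := p) ε c) + if c = ε then V2 else 0 : ℝ)) : ℂ)⁻¹
    refine ⟨Lam m ε Φ', ⟨_, Lam_SBw m h⟩, fun x => ?_⟩
    rw [TT, Tone_Lam μ m hε h, Ttwo_Lam_zero μ k m hε h (by simpa using hs)]
    rw [← hV2]
    set c := max ‖x.2.2‖ ε
    have hc : 0 < c := lt_max_of_lt_right hε
    have hV1 := V1pos μ ε c hε hc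
    have hne : ((((μ.prod μ).real (V1set (p := p) ε c) + if c = ε then V2 else 0 : ℝ)) : ℂ) ≠ 0 := by
      rw [Complex.ofReal_ne_zero]
      split_ifs <;> linarith
    have : m c * (((((μ.prod μ).real (V1set (p := p) ε c) + if c = ε then V2 else 0 : ℝ)) : ℂ)) = 1 := inv_mul_cancel₀ hne
    calc _ = (m c * (((((μ.prod μ).real (V1set (p := p) ε c) + if c = ε then V2 else 0 : ℝ)) : ℂ))) * Φ' x := by
          split_ifs <;> push_cast <;> ring
      _ = _ := by rw [this, one_mul]
  | succ N ih =>
    rintro Φ' ⟨R, h⟩ hs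
    let m : ℝ → ℂ := fun c => ((((μ.prod μ).real (V1set (p := p) ε c) : ℝ)) : ℂ)⁻¹
    have hL := Lam_SBw m h
    have e1 : ∀ x, TT μ k (Lam m ε Φ') x - Φ' x = ∫ v, Ttwo k (Lam m ε Φ') x v ∂(μ.prod μ) := by
      intro x
      rw [TT, Tone_Lam μ m hε h]
      have hV1 := V1pos μ ε (max ‖x.2.2‖ ε) hε (lt_max_of_lt_right hε)
      rw [← mul_assoc, mul_inv_cancel₀ (Complex.ofReal_ne_zero.2 hV1.ne')]
      ring
    obtain ⟨Λ', ⟨R', hΛ'⟩, h'⟩ := ih (fun x => TT μ k (Lam m ε Φ') x - Φ' x)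
      (by
        have hT := TT_SBw μ k hL
        refine ⟨max (max R ε) R, ?_, ?_⟩
        · intro x y hxy
          beta_reduce
          rw [hT.1 x y hxy, h.1 x y hxy]
        · intro x hx
          beta_reduce
          rw [hT.2 x ((le_max_left _ _).trans_lt hx), h.2 x ((le_max_right _ _).trans_lt hx), sub_zero])
      (by
        intro a B C hB
        rw [e1]
        exact Ttwo_Lam_supp μ k N m hε hs a B C hB)
    refine ⟨fun x => Lam m ε Φ' x - Λ' x, ⟨max (max R ε) R', ?_, ?_⟩, ?_⟩
    · intro x y hxy
      beta_reduce
      rw [hL.1 x y hxy, hΛ'.1 x y hxy]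
    · intro x hx
      beta_reduce
      rw [hL.2 x ((le_max_left _ _).trans_lt hx), hΛ'.2 x ((le_max_right _ _).trans_lt hx), sub_zero]
    · intro x
      rw [TT_sub μ k (hL.sb hε) (hΛ'.sb hε), h']
      ring

lemma TT_surj (k : ℕ) {Φ' : P × (ℚ_[p] × ℚ_[p]) → ℂ} (h : IsSchwartzBruhat Φ') :
    ∃ Λ, IsSchwartzBruhat Λ ∧ ∀ x, TT μ k Λ x = Φ' x := by
  obtain ⟨ε, hε, R, hR, hw⟩ := sb_exists h
  have hp1 : (1:ℝ) < p := by exact_mod_cast hp.out.one_lt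
  obtain ⟨N, hN⟩ := pow_unbounded_of_one_lt (R / ε) hp1
  obtain ⟨Λ, ⟨R', h'⟩, hT⟩ := TT_surj_aux μ k hε N Φ' ⟨R, hw⟩ (by
    intro a B C hB
    apply hw.2
    rw [div_lt_iff₀ hε] at hN
    have : R < ‖B‖ := by linarith
    simp [Prod.norm_def, this])
  exact ⟨Λ, h'.sb hε, hT⟩
end Surj

section indsec
set_option linter.unusedSectionVars false
open scoped ENNReal

lemma haar_prod {X Y : Type*} [NormedAddCommGroup X] [ProperSpace X] [MeasurableSpace X] [BorelSpace X]
    [NormedAddCommGroup Y] [ProperSpace Y] [MeasurableSpace Y] [BorelSpace Y]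
    (νX : Measure X) [νX.IsAddHaarMeasure] (νY : Measure Y) [νY.IsAddHaarMeasure] : (νX.prod νY).IsAddHaarMeasure := by
  infer_instance

lemma haar_transfer {X Y : Type*} [NormedAddCommGroup X] [ProperSpace X] [MeasurableSpace X] [BorelSpace X]
    [NormedAddCommGroup Y] [ProperSpace Y] [MeasurableSpace Y] [BorelSpace Y]
    (e : X ≃+ Y) (he : Continuous e) (he' : Continuous e.symm) (νX : Measure X) [νX.IsAddHaarMeasure] (νY : Measure Y) [νY.IsAddHaarMeasure] :
    ∃ c : ℂ, c ≠ 0 ∧ ∀ f : Y → ℂ, ∫ x, f (e x) ∂νX = c * ∫ y, f y ∂νY := by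
  have h1 : (Measure.map e νX).IsAddHaarMeasure := e.isAddHaarMeasure_map νX he he'
  have h2 := Measure.isAddLeftInvariant_eq_smul (Measure.map e νX) νY
  set c := Measure.addHaarScalarFactor (Measure.map e νX) νY with hc
  have hc0 : c ≠ 0 := (Measure.addHaarScalarFactor_pos_of_isAddHaarMeasure _ _).ne'
  refine ⟨((c : ℝ) : ℂ), by simpa using hc0, fun f => ?_⟩
  let E : X ≃ₜ Y := ⟨e.toEquiv, he, he'⟩
  have h3 : ∫ x, f (e x) ∂νX = ∫ y, f y ∂(Measure.map e νX) :=
    (E.measurableEmbedding.integral_map f).symm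
  rw [h3, h2, integral_smul_nnreal_measure]
  rfl

variable {p : ℕ} [hp : Fact p.Prime] [MeasurableSpace ℚ_[p]] [BorelSpace ℚ_[p]]
    (μ : Measure ℚ_[p]) [μ.IsAddHaarMeasure]
variable {P : Type*} [NormedAddCommGroup P] [ProperSpace P] [MeasurableSpace P] [BorelSpace P]
variable {P' : Type*} [NormedAddCommGroup P'] [ProperSpace P'] [MeasurableSpace P'] [BorelSpace P']

/-- weighted pushforward integral -/
def II (ν : Measure P) (q : P → ℚ_[p]) (k : ℕ) (Φ : P × (ℚ_[p] × ℚ_[p]) → ℂ) (g : ℚ_[p] → ℂ) : ℂ :=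
  ∫ x, g (q x.1 + x.2.1 * x.2.2) * (‖x.2.2‖ : ℂ) ^ k * Φ x ∂(ν.prod (μ.prod μ))

/-- the reduction property -/
def Good (ν : Measure P) (q : P → ℚ_[p]) (n : ℕ) : Prop := ∀ k : ℕ,
  (∀ Φ : P × (ℚ_[p] × ℚ_[p]) → ℂ, IsSchwartzBruhat Φ → ∃ Φ₂ : ℚ_[p] × (ℚ_[p] × ℚ_[p]) → ℂ, IsSchwartzBruhat Φ₂ ∧
    ∀ g : ℚ_[p] → ℂ, Continuous g → II μ ν q k Φ g = II μ μ (fun A => A ^ 2) (k + n) Φ₂ g) ∧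
  (∀ Φ₂ : ℚ_[p] × (ℚ_[p] × ℚ_[p]) → ℂ, IsSchwartzBruhat Φ₂ → ∃ Φ : P × (ℚ_[p] × ℚ_[p]) → ℂ, IsSchwartzBruhat Φ ∧
    ∀ g : ℚ_[p] → ℂ, Continuous g → II μ ν q k Φ g = II μ μ (fun A => A ^ 2) (k + n) Φ₂ g)

lemma Good_zero : Good μ μ (fun A => A ^ 2) 0 := fun _ =>
  ⟨fun Φ h => ⟨Φ, h, fun _ _ => rfl⟩, fun Φ h => ⟨Φ, h, fun _ _ => rfl⟩⟩

/-- reshuffle -/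
def shufH (P : Type*) [TopologicalSpace P] (Y : Type*) [TopologicalSpace Y] : (P × Y) × Y ≃ₜ P × (Y × Y) :=
  (Homeomorph.prodAssoc P Y Y).trans ((Homeomorph.refl P).prodCongr (Homeomorph.prodComm Y Y))

lemma II_step (ν : Measure P) [ν.IsAddHaarMeasure] (q : P → ℚ_[p]) (hq : Continuous q) (k : ℕ)
    (Ψ : P × ((ℚ_[p] × ℚ_[p]) × (ℚ_[p] × ℚ_[p])) → ℂ) (h : IsSchwartzBruhat Ψ) (g : ℚ_[p] → ℂ) (hg : Continuous g) :
    II μ (ν.prod (μ.prod μ)) (fun a => q a.1 + a.2.1 * a.2.2) k (fun x => Ψ (shufH _ _ x)) g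
      = II μ ν q (k + 1) (TT μ k Ψ) g := by
  have hc := h.continuous
  have hT : IsSchwartzBruhat (TT μ k Ψ) := by
    obtain ⟨ε, hε, R, hR, hw⟩ := sb_exists h
    exact (TT_SBw μ k hw).sb hε
  have hTc := hT.continuous
  unfold II
  set ρ := μ.prod μ
  let F : P × ((ℚ_[p] × ℚ_[p]) × (ℚ_[p] × ℚ_[p])) → ℂ := fun x =>
    g (q x.1 + (x.2.1.1 * x.2.1.2 + x.2.2.1 * x.2.2.2)) * (‖x.2.1.2‖ : ℂ) ^ k * Ψ x
  have hmp : MeasurePreserving (shufH P (ℚ_[p] × ℚ_[p])) ((ν.prod ρ).prod ρ) (ν.prod (ρ.prod ρ)) := by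
    have h1 := measurePreserving_prodAssoc ν ρ ρ
    have h2 : MeasurePreserving (Prod.swap : (ℚ_[p] × ℚ_[p]) × (ℚ_[p] × ℚ_[p]) → _) (ρ.prod ρ) (ρ.prod ρ) := Measure.measurePreserving_swap
    exact ((MeasurePreserving.id ν).prod h2).comp h1
  have h1 : ∫ x, g (q x.1.1 + x.1.2.1 * x.1.2.2 + x.2.1 * x.2.2) * (‖x.2.2‖ : ℂ) ^ k * Ψ (shufH _ _ x) ∂((ν.prod ρ).prod ρ)
     = ∫ x, F x ∂(ν.prod (ρ.prod ρ)) := by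
    rw [← hmp.integral_comp (shufH P (ℚ_[p] × ℚ_[p])).measurableEmbedding]
    congr 1; ext x
    simp only [F, shufH]
    congr 3
    change _ = q x.1.1 + (x.2.1 * x.2.2 + x.1.2.1 * x.1.2.2)
    ring
  rw [h1, integral_prod, integral_prod]
  · congr 1; ext a
    have := TT_identity μ k h a (fun s => g (q a + s)) (by fun_prop)
    exact this
  · apply Continuous.integrable_of_hasCompactSupport
    · fun_prop
    · exact hT.2.mul_left
  · apply Continuous.integrable_of_hasCompactSupport
    · fun_prop
    · exact h.2.mul_left

lemma Good_succ (ν : Measure P) [ν.IsAddHaarMeasure] (q : P → ℚ_[p]) (hq : Continuous q) {n : ℕ} (H : Good μ ν q n) :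
    Good μ (ν.prod (μ.prod μ)) (fun a => q a.1 + a.2.1 * a.2.2) (n + 1) := by
  intro k
  obtain ⟨H1, H2⟩ := H (k + 1)
  have e : k + 1 + n = k + (n + 1) := by ring
  rw [e] at H1 H2
  constructor
  · intro Φ hΦ
    let Ψ : P × ((ℚ_[p] × ℚ_[p]) × (ℚ_[p] × ℚ_[p])) → ℂ := fun x => Φ ((shufH _ _).symm x)
    have hΨ : IsSchwartzBruhat Ψ := hΦ.comp_homeo _
    have hT : IsSchwartzBruhat (TT μ k Ψ) := by
      obtain ⟨ε, hε, R, hR, hw⟩ := sb_exists hΨ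
      exact (TT_SBw μ k hw).sb hε
    obtain ⟨Φ₂, h2, h3⟩ := H1 _ hT
    refine ⟨Φ₂, h2, fun g hg => ?_⟩
    rw [← h3 g hg, ← II_step μ ν q hq k Ψ hΨ g hg]
    simp [Ψ]
  · intro Φ₂ h2
    obtain ⟨Φ', h', h3⟩ := H2 Φ₂ h2
    obtain ⟨Λ, hΛ, h4⟩ := TT_surj μ k h'
    refine ⟨fun x => Λ (shufH _ _ x), hΛ.comp_homeo _, fun g hg => ?_⟩
    rw [II_step μ ν q hq k Λ hΛ g hg, ← h3 g hg]
    congr 1; ext x; exact h4 x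

lemma Good_transfer (ν : Measure P) [ν.IsAddHaarMeasure] (ν' : Measure P') [ν'.IsAddHaarMeasure] (q : P → ℚ_[p]) (q' : P' → ℚ_[p])
    (e : P' ≃+ P) (he : Continuous e) (he' : Continuous e.symm) (hqq : ∀ x, q' x = q (e x)) {n : ℕ} (H : Good μ ν q n) :
    Good μ ν' q' n := by
  let e2 : P' × (ℚ_[p] × ℚ_[p]) ≃+ P × (ℚ_[p] × ℚ_[p]) := AddEquiv.prodCongr e (AddEquiv.refl _)
  have hc2 : Continuous e2 := (he.prodMap continuous_id : _)
  have hc2' : Continuous e2.symm := (he'.prodMap continuous_id : _)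
  let E : P' × (ℚ_[p] × ℚ_[p]) ≃ₜ P × (ℚ_[p] × ℚ_[p]) := ⟨e2.toEquiv, hc2, hc2'⟩
  have := haar_prod μ μ
  have := haar_prod ν (μ.prod μ)
  have := haar_prod ν' (μ.prod μ)
  obtain ⟨c, hc, h⟩ := haar_transfer e2 hc2 hc2' (ν'.prod (μ.prod μ)) (ν.prod (μ.prod μ))
  have key : ∀ k (Φ : P × (ℚ_[p] × ℚ_[p]) → ℂ) g, II μ ν' q' k (fun x => Φ (E x)) g = II μ ν q k (fun x => c * Φ x) g := by
    intro k Φ g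
    unfold II
    have := h (fun x => g (q x.1 + x.2.1 * x.2.2) * (‖x.2.2‖ : ℂ) ^ k * Φ x)
    rw [← integral_const_mul] at this
    refine Eq.trans ?_ (this.trans ?_)
    · congr 1; ext x; rw [hqq]; rfl
    · congr 1; ext x; ring
  intro k
  constructor
  · intro Φ hΦ
    obtain ⟨Φ₂, h2, h3⟩ := (H k).1 (fun x => c * Φ (E.symm x)) ((hΦ.comp_homeo E.symm).const_mul c)
    refine ⟨Φ₂, h2, fun g hg => ?_⟩
    rw [← h3 g hg, ← key k (fun x => Φ (E.symm x))]
    simp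
  · intro Φ₂ h2
    obtain ⟨Φ, hΦ, h3⟩ := (H k).2 Φ₂ h2
    refine ⟨fun x => c⁻¹ * Φ (E x), (hΦ.comp_homeo E).const_mul _, fun g hg => ?_⟩
    rw [← h3 g hg, key k (fun x => c⁻¹ * Φ x)]
    simp [hc]

/-- splitting off the last two coordinates -/
def spl (p : ℕ) [Fact p.Prime] (m : ℕ) : (Fin (m + 2) → ℚ_[p]) ≃+ (Fin m → ℚ_[p]) × (ℚ_[p] × ℚ_[p]) where
  toFun x := (fun i => x (Fin.castAdd 2 i), (x (Fin.natAdd m 0), x (Fin.natAdd m 1)))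
  invFun y := Fin.append y.1 ![y.2.1, y.2.2]
  left_inv x := by
    ext i
    refine Fin.addCases (fun i => ?_) (fun i => ?_) i
    · simp [Fin.append_left]
    · refine (Fin.append_right _ _ _).trans ?_; fin_cases i <;> rfl
  right_inv y := by
    ext i
    · simp [Fin.append_left]
    · simp only [Fin.append_right]; rfl
    · simp only [Fin.append_right]; rfl
  map_add' x y := rfl

lemma spl_cont (m : ℕ) : Continuous (spl p m) := by
  simp only [spl, AddEquiv.coe_mk, Equiv.coe_fn_mk]; fun_prop

lemma spl_cont' (m : ℕ) : Continuous (spl p m).symm := by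
  refine continuous_pi fun i => ?_
  refine Fin.addCases (fun i => ?_) (fun i => ?_) i
  · have : (fun a => (spl p m).symm a (Fin.castAdd 2 i)) = fun a => a.1 i := by
      ext a; exact Fin.append_left _ _ _
    rw [this]; fun_prop
  · have : (fun a => (spl p m).symm a (Fin.natAdd m i)) = fun a => (![a.2.1, a.2.2] : Fin 2 → ℚ_[p]) i := by
      ext a; exact Fin.append_right _ _ _
    rw [this]; fin_cases i <;> simp <;> fun_prop

lemma splitQP_spl (n : ℕ) (x : Fin (2 * n + 1 + 2) → ℚ_[p]) :
    splitQP p (2 * n + 1 + 2) x = splitQP p (2 * n + 1) (spl p _ x).1 + (spl p _ x).2.1 * (spl p _ x).2.2 := by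
  have h1 : ¬ Even (2 * n + 1 + 2) := by simp [Nat.even_add_one]
  have h2 : ¬ Even (2 * n + 1) := by simp
  have h3 : (2 * n + 1 + 2) / 2 = n + 1 := by omega
  have h4 : (2 * n + 1) / 2 = n := by omega
  simp only [splitQP, if_neg h1, if_neg h2, h3, h4, Finset.sum_range_succ]
  refine Eq.trans ?_ (add_assoc _ _ _).symm
  congr 1
  congr 1
  · apply Finset.sum_congr rfl
    intro i hi
    have hi' := Finset.mem_range.1 hi
    simp only [padP]
    rw [dif_pos (by omega), dif_pos (by omega), dif_pos (by omega), dif_pos (by omega)]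
    rfl
  · simp only [padP]
    rw [dif_pos (by omega), dif_pos (by omega)]
    rfl

lemma splitQP_cont (d : ℕ) : Continuous (splitQP p d) := by
  have : ∀ n, Continuous (fun x : Fin d → ℚ_[p] => padP x n) := by
    intro n; unfold padP; split_ifs <;> fun_prop
  unfold splitQP; split_ifs <;> fun_prop

lemma Good_fin (n : ℕ) : ∀ (ν : Measure (Fin (2 * n + 1) → ℚ_[p])) [ν.IsAddHaarMeasure],
    Good μ ν (splitQP p (2 * n + 1)) n := by
  induction n with
  | zero =>
    intro ν _
    refine Good_transfer μ μ ν (fun A => A ^ 2) _ 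
      ((LinearEquiv.funUnique (Fin 1) ℚ_[p] ℚ_[p]).toAddEquiv) ?_ ?_ ?_ (Good_zero μ)
    · exact continuous_apply _
    · refine continuous_pi fun i => ?_
      exact continuous_id
    · intro x; simp [splitQP, padP]
  | succ n ih =>
    intro ν _
    have hG := Good_succ μ (Measure.pi fun _ => μ) _ (splitQP_cont _) (ih (Measure.pi fun _ => μ))
    have := haar_prod μ μ
    have := haar_prod (Measure.pi fun _ : Fin (2 * n + 1) => μ) (μ.prod μ)
    exact Good_transfer μ _ ν _ _ (spl p (2 * n + 1)) (spl_cont _) (spl_cont' _) (fun x => splitQP_spl n x) hG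

end indsec

section Hsec
set_option linter.unusedSectionVars false
open scoped ENNReal
variable {p : ℕ} [hp : Fact p.Prime] [MeasurableSpace ℚ_[p]] [BorelSpace ℚ_[p]]
    (μ : Measure ℚ_[p]) [μ.IsAddHaarMeasure]

/-- change of variables to the fibration over the value of the form -/
def tauM (x : ℚ_[p] × (ℚ_[p] × ℚ_[p])) : ℚ_[p] × (ℚ_[p] × ℚ_[p]) :=
  (x.1 ^ 2 + x.2.1 * x.2.2, (x.2.2, x.1))

lemma measurable_tauM : Measurable (tauM (p := p)) := by
  unfold tauM; fun_prop

lemma lintegral_tau (F : ℚ_[p] × (ℚ_[p] × ℚ_[p]) → ℝ≥0∞) (hF : Measurable F) :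
    ∫⁻ x, F x ∂(μ.prod (μ.prod μ)) = ∫⁻ x, ‖x.2.2‖ₑ * F (tauM x) ∂(μ.prod (μ.prod μ)) := by
  have h1 : ∫⁻ x, F x ∂(μ.prod (μ.prod μ)) = ∫⁻ t, ∫⁻ u, ∫⁻ ξ, F (ξ, (t, u)) ∂μ ∂μ ∂μ := by
    rw [lintegral_prod_symm' _ hF, lintegral_prod _ (by fun_prop)]
  have hm := measurable_tauM (p := p)
  have h2 : ∫⁻ x, ‖x.2.2‖ₑ * F (tauM x) ∂(μ.prod (μ.prod μ)) =
      ∫⁻ C, ∫⁻ A, ∫⁻ B, ‖C‖ₑ * F (A ^ 2 + B * C, (C, A)) ∂μ ∂μ ∂μ := by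
    rw [lintegral_prod _ (by fun_prop)]
    have : ∀ A, ∫⁻ y : ℚ_[p] × ℚ_[p], ‖y.2‖ₑ * F (tauM (A, y)) ∂(μ.prod μ) = ∫⁻ C, ∫⁻ B, ‖C‖ₑ * F (A ^ 2 + B * C, (C, A)) ∂μ ∂μ := by
      intro A
      rw [lintegral_prod_symm' _ (by fun_prop)]
      rfl
    simp only [this]
    rw [lintegral_lintegral_swap]
    fun_prop
  rw [h1, h2]
  apply lintegral_congr_ae
  filter_upwards [compl_mem_ae_iff.2 (measure_singleton (μ := μ) 0)] with C hC
  congr 1; ext A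
  rw [lintegral_const_mul _ (by fun_prop), ← lintegral_add_left_eq_self _ (A ^ 2), haar_map_mul μ C hC _ (by fun_prop)]
  simp only [mul_comm]

lemma integral_tau (K : ℚ_[p] × (ℚ_[p] × ℚ_[p]) → ℂ) (hK : Measurable K) :
    (Integrable (fun x => (‖x.2.2‖ : ℂ) * K (tauM x)) (μ.prod (μ.prod μ)) → Integrable K (μ.prod (μ.prod μ))) ∧ 
    ∫ x, K x ∂(μ.prod (μ.prod μ)) = ∫ x, (‖x.2.2‖ : ℂ) * K (tauM x) ∂(μ.prod (μ.prod μ)) := by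
  set ρ := μ.prod (μ.prod μ)
  have hm := measurable_tauM (p := p)
  have hd : Measurable (fun x : ℚ_[p] × (ℚ_[p] × ℚ_[p]) => ‖x.2.2‖₊) := by fun_prop
  have key : ρ = Measure.map tauM (ρ.withDensity (fun x => (‖x.2.2‖₊ : ℝ≥0∞))) := by
    ext s hs
    rw [Measure.map_apply hm hs, withDensity_apply _ (hm hs), ← lintegral_indicator_one hs, lintegral_tau μ _ (measurable_one.indicator hs),
      ← lintegral_indicator (hm hs)]
    refine lintegral_congr fun x => ?_
    by_cases h : tauM x ∈ s
    · have h' : x ∈ tauM ⁻¹' s := h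
      simp [h, h', enorm]
    · have h' : x ∉ tauM ⁻¹' s := h
      simp [h, h']
  constructor
  · intro hi
    rw [key, integrable_map_measure hK.aestronglyMeasurable hm.aemeasurable, integrable_withDensity_iff_integrable_smul hd]
    exact hi
  · conv_lhs => rw [key]
    rw [integral_map hm.aemeasurable hK.aestronglyMeasurable, integral_withDensity_eq_integral_smul hd]
    rfl

lemma wt_eq (n : ℕ) (t : ℚ_[p]) (ht : t ≠ 0) :
    ‖t‖ ^ ((((2 * n + 3 : ℕ) : ℝ) - 5) / 2) = ‖t‖ ^ n * ‖t‖⁻¹ := by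
  have h0 : 0 < ‖t‖ := norm_pos_iff.2 ht
  have : (((2 * n + 3 : ℕ) : ℝ) - 5) / 2 = (n : ℝ) - 1 := by push_cast; ring
  rw [this, Real.rpow_sub h0, Real.rpow_natCast, Real.rpow_one, div_eq_mul_inv]

/-- the integrand of `hThreeP` -/
def FF (n : ℕ) (Φ₂ : ℚ_[p] × ℚ_[p] × ℚ_[p] → ℂ) (x : ℚ_[p] × (ℚ_[p] × ℚ_[p])) : ℂ :=
  Φ₂ (x.2.2, (x.1 - x.2.2 ^ 2) / x.2.1, x.2.1) * ((‖x.2.1‖ ^ ((((2 * n + 3 : ℕ) : ℝ) - 5) / 2) : ℝ) : ℂ)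

lemma FF_meas (n : ℕ) {Φ₂ : ℚ_[p] × ℚ_[p] × ℚ_[p] → ℂ} (h : IsSchwartzBruhat Φ₂) : Measurable (FF n Φ₂) := by
  have hm := h.continuous.measurable
  unfold FF
  have : Measurable (fun x : ℚ_[p] × (ℚ_[p] × ℚ_[p]) => (x.2.2, (x.1 - x.2.2 ^ 2) / x.2.1, x.2.1)) := by
    simp only [div_eq_mul_inv]
    fun_prop
  exact (hm.comp this).mul (by fun_prop)

lemma ae_ne : ∀ᵐ x : ℚ_[p] × (ℚ_[p] × ℚ_[p]) ∂(μ.prod (μ.prod μ)), x.2.2 ≠ 0 := by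
  have h1 : ∀ᵐ c ∂μ, c ≠ 0 := compl_mem_ae_iff.2 (measure_singleton (μ := μ) 0)
  have h2 : Measure.QuasiMeasurePreserving (fun x : ℚ_[p] × (ℚ_[p] × ℚ_[p]) => x.2.2) (μ.prod (μ.prod μ)) μ :=
    Measure.quasiMeasurePreserving_snd.comp Measure.quasiMeasurePreserving_snd
  exact h2.ae h1

lemma FF_tau (n : ℕ) (Φ₂ : ℚ_[p] × ℚ_[p] × ℚ_[p] → ℂ) (g : ℚ_[p] → ℂ) :
    (fun x => (‖x.2.2‖ : ℂ) * (fun y => g y.1 * FF n Φ₂ y) (tauM x)) =ᵐ[μ.prod (μ.prod μ)]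
     (fun x => g (x.1 ^ 2 + x.2.1 * x.2.2) * (‖x.2.2‖ : ℂ) ^ n * Φ₂ x) := by
  filter_upwards [ae_ne μ] with x hx
  have h0 : (‖x.2.2‖ : ℂ) ≠ 0 := by simpa using hx
  simp only [FF, tauM, add_sub_cancel_left, mul_div_cancel_right₀ _ hx, wt_eq n _ hx]
  push_cast
  field_simp

lemma FF_int_g (n : ℕ) {Φ₂ : ℚ_[p] × ℚ_[p] × ℚ_[p] → ℂ} (h : IsSchwartzBruhat Φ₂) (g : ℚ_[p] → ℂ) (hg : Continuous g) :
    Integrable (fun y => g y.1 * FF n Φ₂ y) (μ.prod (μ.prod μ)) ∧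
    ∫ y, g y.1 * FF n Φ₂ y ∂(μ.prod (μ.prod μ)) = II μ μ (fun A => A ^ 2) n Φ₂ g := by
  have hm : Measurable (fun y : ℚ_[p] × (ℚ_[p] × ℚ_[p]) => g y.1 * FF n Φ₂ y) :=
    (hg.measurable.comp measurable_fst).mul (FF_meas n h)
  obtain ⟨h1, h2⟩ := integral_tau μ _ hm
  have hc := h.continuous
  refine ⟨h1 ?_, ?_⟩
  · refine (integrable_congr (FF_tau μ n Φ₂ g)).2 ?_
    apply Continuous.integrable_of_hasCompactSupport
    · fun_prop
    · exact h.2.mul_left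
  · rw [h2, integral_congr_ae (FF_tau μ n Φ₂ g)]
    rfl

lemma FF_integrable (n : ℕ) {Φ₂ : ℚ_[p] × ℚ_[p] × ℚ_[p] → ℂ} (h : IsSchwartzBruhat Φ₂) :
    Integrable (FF n Φ₂) (μ.prod (μ.prod μ)) := by
  simpa using (FF_int_g μ n h (fun _ => 1) continuous_const).1

lemma restr_eq : μ.restrict ({0}ᶜ : Set ℚ_[p]) = μ :=
  Measure.restrict_eq_self_of_ae_mem (compl_mem_ae_iff.2 (measure_singleton (μ := μ) 0))

lemma h_ae (n : ℕ) {Φ₂ : ℚ_[p] × ℚ_[p] × ℚ_[p] → ℂ} (h : IsSchwartzBruhat Φ₂) :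
    hThreeP p μ (2 * n + 3) Φ₂ =ᵐ[μ] fun ξ => ∫ y, FF n Φ₂ (ξ, y) ∂(μ.prod μ) := by
  filter_upwards [(FF_integrable μ n h).prod_right_ae] with ξ hξ
  rw [integral_prod _ hξ, hThreeP, restr_eq]
  rfl

lemma h_locint (n : ℕ) {Φ₂ : ℚ_[p] × ℚ_[p] × ℚ_[p] → ℂ} (h : IsSchwartzBruhat Φ₂) :
    LocallyIntegrable (hThreeP p μ (2 * n + 3) Φ₂) μ :=
  ((integrable_congr (h_ae μ n h)).2 (FF_integrable μ n h).integral_prod_left).locallyIntegrable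

lemma h_int (n : ℕ) {Φ₂ : ℚ_[p] × ℚ_[p] × ℚ_[p] → ℂ} (h : IsSchwartzBruhat Φ₂) (g : ℚ_[p] → ℂ) (hg : Continuous g) :
    ∫ ξ, g ξ * hThreeP p μ (2 * n + 3) Φ₂ ξ ∂μ = II μ μ (fun A => A ^ 2) n Φ₂ g := by
  obtain ⟨h1, h2⟩ := FF_int_g μ n h g hg
  rw [← h2, integral_prod _ h1]
  apply integral_congr_ae
  filter_upwards [h_ae μ n h] with ξ hξ
  rw [hξ, ← integral_const_mul]

lemma haar_closedBall (x c : ℚ_[p]) (hc : c ≠ 0) (R : ℝ) :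
    μ (Metric.closedBall x (‖c‖ * R)) = ‖c‖ₑ * μ (Metric.closedBall 0 R) := by
  have hcp : 0 < ‖c‖ := norm_pos_iff.2 hc
  rw [← measure_preimage_add μ x, ← lintegral_indicator_one (by
      apply measurableSet_preimage (by fun_prop) Metric.isClosed_closedBall.measurableSet),
    haar_map_mul μ c hc _ (measurable_one.indicator (by
      apply measurableSet_preimage (by fun_prop) Metric.isClosed_closedBall.measurableSet)),
    ← lintegral_indicator_one Metric.isClosed_closedBall.measurableSet]
  congr 2; ext y
  have : c * y ∈ (fun h => x + h) ⁻¹' Metric.closedBall x (‖c‖ * R) ↔ y ∈ Metric.closedBall (0 : ℚ_[p]) R := by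
    simp only [Set.mem_preimage, Metric.mem_closedBall, dist_eq_norm, add_sub_cancel_left, norm_mul, sub_zero]
    exact mul_le_mul_iff_right₀ hcp
  by_cases h : y ∈ Metric.closedBall (0 : ℚ_[p]) R
  · rw [Set.indicator_of_mem h, Set.indicator_of_mem (this.2 h)]; rfl
  · rw [Set.indicator_of_notMem h, Set.indicator_of_notMem (fun h' => h (this.1 h'))]

lemma fibre_set (ξ : ℚ_[p]) (hξ : ξ ≠ 0) (R : ℝ) (hR : 0 < R) : ∃ K : ℝ≥0∞, K ≠ ⊤ ∧ ∀ t : ℚ_[p], t ≠ 0 →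
    μ {u | ‖u‖ ≤ R ∧ ‖ξ - u ^ 2‖ ≤ R * ‖t‖} ≤ ‖t‖ₑ * K := by
  have hx : 0 < ‖ξ‖ := norm_pos_iff.2 hξ
  set V := μ (Metric.closedBall (0 : ℚ_[p]) R) with hV
  have hVt : V ≠ ⊤ := measure_closedBall_lt_top.ne
  set a := ENNReal.ofReal (R / ‖ξ‖)
  set b := ENNReal.ofReal ((‖(2 : ℚ_[p])‖ * √‖ξ‖)⁻¹)
  refine ⟨a * V + (b * V + b * V), by finiteness, fun t ht => ?_⟩
  rw [mul_add]
  by_cases hc : ‖ξ‖ ≤ R * ‖t‖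
  · refine le_trans ?_ le_self_add
    have h1 : 1 ≤ ‖t‖ₑ * a := by
      rw [← ofReal_norm, ← ENNReal.ofReal_mul (norm_nonneg _), ENNReal.one_le_ofReal]
      rw [mul_div_assoc', le_div_iff₀ hx]; linarith
    calc _ ≤ V := measure_mono (fun u hu => by simpa using hu.1)
      _ = 1 * V := (one_mul _).symm
      _ ≤ _ := by rw [← mul_assoc]; gcongr
  · push Not at hc
    refine le_trans ?_ le_add_self
    rcases Set.eq_empty_or_nonempty {u | ‖u‖ ≤ R ∧ ‖ξ - u ^ 2‖ ≤ R * ‖t‖} with he | ⟨u₀, -, hu₀⟩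
    · rw [he]; simp
    have h0 : ‖u₀ ^ 2‖ = ‖ξ‖ := by
      have : ‖ξ - u₀ ^ 2‖ < ‖ξ‖ := hu₀.trans_lt hc
      by_contra hne
      have h4 := IsUltrametricDist.norm_add_eq_max_of_norm_ne_norm (x := u₀^2) (y := -ξ) (by rwa [norm_neg])
      rw [norm_neg, ← sub_eq_add_neg, norm_sub_rev] at h4
      have := le_max_right ‖u₀ ^ 2‖ ‖ξ‖
      linarith
    have h0' : ‖u₀‖ = √‖ξ‖ := by
      rw [← h0, norm_pow, Real.sqrt_sq (norm_nonneg _)]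
    have hu0 : u₀ ≠ 0 := by rintro rfl; simp at h0; exact hx.ne h0
    have h2 : (2 : ℚ_[p]) ≠ 0 := two_ne_zero
    have h2u : 2 * u₀ ≠ 0 := mul_ne_zero h2 hu0
    have h2p : 0 < ‖2 * u₀‖ := norm_pos_iff.2 h2u
    have hb : ‖(2 * u₀)⁻¹‖ₑ = b := by
      rw [← ofReal_norm, norm_inv, norm_mul, h0']
    have hball : ∀ c, μ (Metric.closedBall c (‖t * (2 * u₀)⁻¹‖ * R)) = ‖t‖ₑ * (b * V) := by
      intro c
      rw [haar_closedBall μ c _ (mul_ne_zero ht (inv_ne_zero h2u)), enorm_mul, hb, mul_assoc]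
    have hsub : {u | ‖u‖ ≤ R ∧ ‖ξ - u ^ 2‖ ≤ R * ‖t‖} ⊆
        Metric.closedBall u₀ (‖t * (2 * u₀)⁻¹‖ * R) ∪ Metric.closedBall (-u₀) (‖t * (2 * u₀)⁻¹‖ * R) := by
      rintro u ⟨-, hu⟩
      have h5 : ‖(u - u₀) * (u + u₀)‖ ≤ R * ‖t‖ := by
        have e : (u - u₀) * (u + u₀) = (ξ - u₀ ^ 2) + -(ξ - u ^ 2) := by ring
        rw [e]
        refine (IsUltrametricDist.norm_add_le_max _ _).trans (max_le hu₀ ?_)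
        rwa [norm_neg]
      rw [norm_mul] at h5
      have h6 : ‖2 * u₀‖ ≤ max ‖u + u₀‖ ‖u - u₀‖ := by
        have e : 2 * u₀ = (u + u₀) + -(u - u₀) := by ring
        rw [e]
        refine (IsUltrametricDist.norm_add_le_max _ _).trans ?_
        rw [norm_neg]
      have e7 : ‖t * (2 * u₀)⁻¹‖ * R = R * ‖t‖ / ‖2 * u₀‖ := by
        rw [norm_mul, norm_inv]; field_simp
      rw [e7]
      rcases le_max_iff.1 h6 with h | h
      · left
        rw [Metric.mem_closedBall, dist_eq_norm, le_div_iff₀ h2p]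
        exact (mul_le_mul_of_nonneg_left h (norm_nonneg _)).trans h5
      · right
        rw [Metric.mem_closedBall, dist_eq_norm, sub_neg_eq_add, le_div_iff₀ h2p]
        refine (mul_le_mul_of_nonneg_left h (norm_nonneg _)).trans ?_
        rwa [mul_comm]
    refine (measure_mono hsub).trans ((measure_union_le _ _).trans ?_)
    rw [hball, hball, mul_add]

lemma fibre_int (n : ℕ) {Φ₂ : ℚ_[p] × ℚ_[p] × ℚ_[p] → ℂ} (h : IsSchwartzBruhat Φ₂) (ξ : ℚ_[p]) (hξ : ξ ≠ 0) :
    Integrable (fun y => FF n Φ₂ (ξ, y)) (μ.prod μ) := by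
  have hm : Measurable (fun y => FF n Φ₂ (ξ, y)) := (FF_meas n h).comp (by fun_prop)
  refine ⟨hm.aestronglyMeasurable, ?_⟩
  obtain ⟨ε, hε, R, hR, hw⟩ := sb_exists h
  obtain ⟨M, hM, hb⟩ := h.bdd
  obtain ⟨K, hK, hs⟩ := fibre_set μ ξ hξ R hR
  rw [hasFiniteIntegral_iff_enorm, lintegral_prod _ hm.enorm.aemeasurable]
  have bound : ∀ᵐ t ∂μ, ∫⁻ u, ‖FF n Φ₂ (ξ, (t, u))‖ₑ ∂μ ≤
      (Metric.closedBall (0 : ℚ_[p]) R).indicator (fun _ => ENNReal.ofReal (M * R ^ n) * K) t := by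
    filter_upwards [compl_mem_ae_iff.2 (measure_singleton (μ := μ) 0)] with t ht
    have ht0 : t ≠ 0 := ht
    have htp : 0 < ‖t‖ := norm_pos_iff.2 ht0
    by_cases htR : ‖t‖ ≤ R
    · rw [Set.indicator_of_mem (by simpa using htR)]
      have : ∀ u, ‖FF n Φ₂ (ξ, (t, u))‖ₑ ≤
          ({u | ‖u‖ ≤ R ∧ ‖ξ - u ^ 2‖ ≤ R * ‖t‖} : Set ℚ_[p]).indicator (fun _ => ENNReal.ofReal (M * R ^ n * ‖t‖⁻¹)) u := by
        intro u
        by_cases hu : u ∈ {u | ‖u‖ ≤ R ∧ ‖ξ - u ^ 2‖ ≤ R * ‖t‖}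
        · rw [Set.indicator_of_mem hu, ← ofReal_norm]
          apply ENNReal.ofReal_le_ofReal
          simp only [FF, norm_mul, Complex.norm_real, wt_eq n t ht0]
          rw [Real.norm_of_nonneg (by positivity), Real.norm_of_nonneg (by positivity), mul_assoc]
          gcongr
          exact hb _
        · rw [Set.indicator_of_notMem hu]
          have : Φ₂ (u, (ξ - u ^ 2) / t, t) = 0 := by
            apply hw.2
            by_contra hc
            push Not at hc
            apply hu
            simp only [Prod.norm_def, sup_le_iff, norm_div] at hc
            refine ⟨hc.1, ?_⟩
            have := hc.2.1
            rwa [div_le_iff₀ htp] at this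
          simp [FF, this]
      refine (lintegral_mono this).trans ?_
      refine (lintegral_indicator_const_le _ _).trans ?_
      refine (mul_le_mul_right (hs t ht0) _).trans (le_of_eq ?_)
      rw [← mul_assoc, ← ofReal_norm, ← ENNReal.ofReal_mul (by positivity)]
      congr 2
      field_simp
    · rw [Set.indicator_of_notMem (by simpa using htR)]
      have : ∀ u, FF n Φ₂ (ξ, (t, u)) = 0 := by
        intro u
        have : Φ₂ (u, (ξ - u ^ 2) / t, t) = 0 := by
          apply hw.2
          simp only [Prod.norm_def, lt_sup_iff]
          right; right; exact not_le.1 htR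
        simp [FF, this]
      simp [this]
  refine (lintegral_mono_ae bound).trans_lt ?_
  rw [lintegral_indicator_const Metric.isClosed_closedBall.measurableSet]
  have : μ (Metric.closedBall (0 : ℚ_[p]) R) ≠ ⊤ := measure_closedBall_lt_top.ne
  finiteness

end Hsec

/-- `p`-adic, odd-dimensional case of the reduction of pushforwards under
the split quadratic form in `d` variables to twisted pushforwards in `3` variables. -/
theorem pushforward_eq_twisted_pushforward_padic_odd (p : ℕ) [Fact p.Prime]
    [MeasurableSpace ℚ_[p]] [BorelSpace ℚ_[p]]
    (μ : Measure ℚ_[p]) [μ.IsAddHaarMeasure]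
    (d : ℕ) (hd : 3 ≤ d) (hdo : Odd d)
    (μd : Measure (Fin d → ℚ_[p])) [μd.IsAddHaarMeasure] :
    (∀ Φ₂ : ℚ_[p] × ℚ_[p] × ℚ_[p] → ℂ, IsSchwartzBruhat Φ₂ →
      (∀ ξ : ℚ_[p], ξ ≠ 0 → IntegrableOn
          (fun q : ℚ_[p] × ℚ_[p] =>
            Φ₂ (q.2, (ξ - q.2 ^ 2) / q.1, q.1) * ((‖q.1‖ ^ (((d : ℝ) - 5) / 2) : ℝ) : ℂ))
          (({0}ᶜ : Set ℚ_[p]) ×ˢ (Set.univ : Set ℚ_[p])) (μ.prod μ)) ∧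
      LocallyIntegrable (hThreeP p μ d Φ₂) μ) ∧
    (∀ Φ : (Fin d → ℚ_[p]) → ℂ, IsSchwartzBruhat Φ →
      ∃ Φ₂ : ℚ_[p] × ℚ_[p] × ℚ_[p] → ℂ, IsSchwartzBruhat Φ₂ ∧
        ∀ g : ℚ_[p] → ℂ, Continuous g → HasCompactSupport g →
          ∫ x, g (splitQP p d x) * Φ x ∂μd = ∫ ξ, g ξ * hThreeP p μ d Φ₂ ξ ∂μ) ∧
    (∀ Φ₂ : ℚ_[p] × ℚ_[p] × ℚ_[p] → ℂ, IsSchwartzBruhat Φ₂ →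
      ∃ Φ : (Fin d → ℚ_[p]) → ℂ, IsSchwartzBruhat Φ ∧
        ∀ g : ℚ_[p] → ℂ, Continuous g → HasCompactSupport g →
          ∫ x, g (splitQP p d x) * Φ x ∂μd = ∫ ξ, g ξ * hThreeP p μ d Φ₂ ξ ∂μ) := by
  obtain ⟨m, hm⟩ := hdo
  obtain ⟨n, rfl⟩ : ∃ n, m = n + 1 := ⟨m - 1, by omega⟩
  obtain rfl : d = 2 * n + 1 + 2 := by omega
  have := haar_prod μ μ
  have := haar_prod (Measure.pi fun _ : Fin (2 * n + 1) => μ) (μ.prod μ)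
  obtain ⟨c, hc, hT⟩ := haar_transfer (spl p (2 * n + 1)) (spl_cont _) (spl_cont' _) μd
    ((Measure.pi fun _ : Fin (2 * n + 1) => μ).prod (μ.prod μ))
  let E : (Fin (2 * n + 1 + 2) → ℚ_[p]) ≃ₜ (Fin (2 * n + 1) → ℚ_[p]) × (ℚ_[p] × ℚ_[p]) :=
    ⟨(spl p (2 * n + 1)).toEquiv, spl_cont _, spl_cont' _⟩
  have key : ∀ (Φ : (Fin (2 * n + 1) → ℚ_[p]) × (ℚ_[p] × ℚ_[p]) → ℂ) (g : ℚ_[p] → ℂ),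
      ∫ x, g (splitQP p (2 * n + 1 + 2) x) * Φ (E x) ∂μd =
        II μ (Measure.pi fun _ : Fin (2 * n + 1) => μ) (splitQP p (2 * n + 1)) 0 (fun x => c * Φ x) g := by
    intro Φ g
    have h := hT (fun x => g (splitQP p (2 * n + 1) x.1 + x.2.1 * x.2.2) * Φ x)
    rw [← integral_const_mul] at h
    refine Eq.trans ?_ (h.trans ?_)
    · congr 1; ext x; rw [splitQP_spl]; rfl
    · unfold II; congr 1; ext x; ring
  have hG := Good_fin μ n (Measure.pi fun _ : Fin (2 * n + 1) => μ) 0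
  rw [zero_add] at hG
  obtain ⟨H1, H2⟩ := hG
  refine ⟨fun Φ₂ h2 => ⟨fun ξ hξ => (fibre_int μ n h2 ξ hξ).integrableOn, h_locint μ n h2⟩, ?_, ?_⟩
  · intro Φ hΦ
    obtain ⟨Φ₂, h2, h3⟩ := H1 (fun x => c * Φ (E.symm x)) ((hΦ.comp_homeo E.symm).const_mul c)
    refine ⟨Φ₂, h2, fun g hg _ => ?_⟩
    refine Eq.trans ?_ (h_int μ n h2 g hg).symm
    rw [← h3 g hg, ← key (fun x => Φ (E.symm x))]
    simp
  · intro Φ₂ h2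
    obtain ⟨Φ, hΦ, h3⟩ := H2 Φ₂ h2
    refine ⟨fun x => c⁻¹ * Φ (E x), (hΦ.comp_homeo E).const_mul _, fun g hg _ => ?_⟩
    refine Eq.trans ?_ (h_int μ n h2 g hg).symm
    rw [← h3 g hg, key (fun x => c⁻¹ * Φ x)]
    simp [hc]
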